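/- Let H be a separable Hilbert space and suppose the update function Φ is almost α-firmly nonexpansive in expectation on H with constant α ∈ (0,1) and violation ε ∈ [0,1): E[‖Φ(x,ξ)−Φ(y,ξ)‖²] ≤ (1+ε)‖x−y‖² − ((1−α)/α) E[‖(x−Φ(x,ξ))−(y−Φ(y,ξ))‖²] for all x,y ∈ H. Then the Markov operator 𝒫 is almost α-firmly nonexpansive in measure on P₂(H) with the same constant and violation at most ε: for all μ₁, μ₂ ∈ P₂(H) and every optimal coupling γ of (μ₁, μ₂), W₂²(μ₁𝒫, μ₂𝒫) ≤ (1+ε) W₂²(μ₁, μ₂) − ((1−α)/α) ∫_{H×H} E[‖(x−Φ(x,ξ))−(y−Φ(y,ξ))‖²] γ(dx,dy). -/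

import Mathlib

open MeasureTheory Filter Topology

noncomputable section

/-- One application of the dual Markov operator of the RFI, with `μξ` the law of `ξ`. -/
def markovStep {G I : Type*} [MeasurableSpace G] [MeasurableSpace I]
    (μξ : MeasureTheory.Measure I) (T : I → G → G) (μ : MeasureTheory.Measure G) :
    MeasureTheory.Measure G :=
  μ.bind fun x => μξ.map fun i => T i x

/-- Squared distance `‖x - y‖²` as an extended nonnegative real. -/
def q2 {H : Type*} [NormedAddCommGroup H] (x y : H) : ENNReal :=
  (‖x - y‖₊ : ENNReal) ^ 2

/-- `γ` is a coupling of `(μ, ν)`: a measure on the product with marginals `μ` and `ν`. -/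
def IsCoupling {H : Type*} [MeasurableSpace H]
    (γ : MeasureTheory.Measure (H × H)) (μ ν : MeasureTheory.Measure H) : Prop :=
  γ.map Prod.fst = μ ∧ γ.map Prod.snd = ν

/-- The squared Wasserstein-2 distance `W₂(μ,ν)²`. -/
def W2sq {H : Type*} [MeasurableSpace H] [NormedAddCommGroup H]
    (μ ν : MeasureTheory.Measure H) : ENNReal :=
  ⨅ (γ : MeasureTheory.Measure (H × H)) (_ : IsCoupling γ μ ν), ∫⁻ p, q2 p.1 p.2 ∂γ

/-- An optimal coupling of `(μ, ν)`: a coupling attaining `W₂(μ,ν)²`. -/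
def IsOptCoupling {H : Type*} [MeasurableSpace H] [NormedAddCommGroup H]
    (γ : MeasureTheory.Measure (H × H)) (μ ν : MeasureTheory.Measure H) : Prop :=
  IsCoupling γ μ ν ∧ ∫⁻ p, q2 p.1 p.2 ∂γ = W2sq μ ν

/-- Membership in `P₂(H)`: probability measures with finite second moment. -/
def MemP2 {H : Type*} [MeasurableSpace H] [NormedAddCommGroup H]
    (μ : MeasureTheory.Measure H) : Prop :=
  MeasureTheory.IsProbabilityMeasure μ ∧ ∃ x : H, ∫⁻ y, q2 x y ∂μ < ⊤

theorem measurable_q2 {H : Type*} [NormedAddCommGroup H] [SecondCountableTopology H]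
    [MeasurableSpace H] [BorelSpace H] : Measurable fun p : H × H => q2 p.1 p.2 := by
  unfold q2
  fun_prop

theorem markovStep_eq_map_prod {G I : Type*} [MeasurableSpace G] [MeasurableSpace I]
    {T : I → G → G} (hΦ : Measurable fun p : G × I => T p.2 p.1)
    (ν : Measure I) [SFinite ν] (μ : Measure G) :
    markovStep ν T μ = (μ.prod ν).map fun p => T p.2 p.1 := by
  ext s hs
  have hT (x : G) : Measurable fun i => T i x := hΦ.comp measurable_prodMk_left
  have hm : Measurable fun x => ν.map fun i => T i x := by
    refine Measure.measurable_of_measurable_coe _ fun t ht => ?_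
    simp_rw [Measure.map_apply (hT _) ht]
    exact measurable_measure_prodMk_left (hΦ ht)
  rw [markovStep, Measure.bind_apply hs hm.aemeasurable, Measure.map_apply hΦ hs,
    Measure.prod_apply (hΦ hs)]
  refine lintegral_congr fun x => ?_
  rw [Measure.map_apply (hT x) hs]
  rfl

/-- Driving both components of a coupling with the same noise couples the images. -/
theorem IsCoupling.map_prod {H I : Type*} [MeasurableSpace H] [MeasurableSpace I]
    {T : I → H → H} (hΦ : Measurable fun p : H × I => T p.2 p.1)
    (ν : Measure I) [SFinite ν] {γ : Measure (H × H)} [SFinite γ] {μ₁ μ₂ : Measure H}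
    (h : IsCoupling γ μ₁ μ₂) :
    IsCoupling ((γ.prod ν).map fun p => (T p.2 p.1.1, T p.2 p.1.2))
      (markovStep ν T μ₁) (markovStep ν T μ₂) := by
  have h₁ : Measurable fun p : (H × H) × I => T p.2 p.1.1 :=
    hΦ.comp (measurable_fst.fst.prodMk measurable_snd)
  have h₂ : Measurable fun p : (H × H) × I => T p.2 p.1.2 :=
    hΦ.comp (measurable_fst.snd.prodMk measurable_snd)
  obtain ⟨rfl, rfl⟩ := h
  constructor
  · rw [Measure.map_map measurable_fst (h₁.prodMk h₂), markovStep_eq_map_prod hΦ,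
      ← Measure.map_id (μ := ν), Measure.map_prod_map γ ν measurable_fst measurable_id,
      Measure.map_map hΦ (by fun_prop), Measure.map_id]
    rfl
  · rw [Measure.map_map measurable_snd (h₁.prodMk h₂), markovStep_eq_map_prod hΦ,
      ← Measure.map_id (μ := ν), Measure.map_prod_map γ ν measurable_snd measurable_id,
      Measure.map_map hΦ (by fun_prop), Measure.map_id]
    rfl

/-- if the update function `Φ(x,i) = T i x` on a separable Hilbert
space is almost α-firmly nonexpansive in expectation with constant `α ∈ (0,1)` and
violation `ε ∈ [0,1)`, then the Markov operator is almost α-firmly nonexpansive in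
measure on `P₂(H)` with the same constant and violation at most `ε`:
`W₂²(μ₁𝒫, μ₂𝒫) + ((1-α)/α) ∫ E[‖(x-Φ(x,ξ)) - (y-Φ(y,ξ))‖²] dγ ≤ (1+ε) W₂²(μ₁,μ₂)`
for every optimal coupling `γ` of `(μ₁, μ₂)`. -/
theorem stmt11
    {H I : Type*} [NormedAddCommGroup H] [InnerProductSpace ℝ H] [CompleteSpace H]
    [SecondCountableTopology H] [MeasurableSpace H] [BorelSpace H] [MeasurableSpace I]
    (T : I → H → H)
    (hΦ : Measurable fun p : H × I => T p.2 p.1)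
    (μξ : Measure I) [IsProbabilityMeasure μξ]
    (α ε : ℝ) (hα0 : 0 < α) (hα1 : α < 1) (hε0 : 0 ≤ ε) (hε1 : ε < 1)
    (haafne : ∀ x y : H,
      (∫⁻ i, q2 (T i x) (T i y) ∂μξ) +
        ENNReal.ofReal ((1 - α) / α) * ∫⁻ i, q2 (x - T i x) (y - T i y) ∂μξ ≤
      ENNReal.ofReal (1 + ε) * q2 x y) :
    ∀ μ₁ μ₂ : Measure H, MemP2 μ₁ → MemP2 μ₂ →
      ∀ γ : Measure (H × H), IsOptCoupling γ μ₁ μ₂ →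
        W2sq (markovStep μξ T μ₁) (markovStep μξ T μ₂) +
          ENNReal.ofReal ((1 - α) / α) *
            ∫⁻ p, (∫⁻ i, q2 (p.1 - T i p.1) (p.2 - T i p.2) ∂μξ) ∂γ ≤
        ENNReal.ofReal (1 + ε) * W2sq μ₁ μ₂ := by
  rintro μ₁ μ₂ ⟨_, -⟩ - γ ⟨hγ, hopt⟩
  have : IsProbabilityMeasure γ := by
    constructor
    have h : μ₁ Set.univ = 1 := measure_univ
    rwa [← hγ.1, Measure.map_apply measurable_fst .univ, Set.preimage_univ] at h
  have h₁ : Measurable fun p : (H × H) × I => T p.2 p.1.1 :=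
    hΦ.comp (measurable_fst.fst.prodMk measurable_snd)
  have h₂ : Measurable fun p : (H × H) × I => T p.2 p.1.2 :=
    hΦ.comp (measurable_fst.snd.prodMk measurable_snd)
  have hq : Measurable fun p : (H × H) × I => q2 (T p.2 p.1.1) (T p.2 p.1.2) :=
    measurable_q2.comp (h₁.prodMk h₂)
  have hW : W2sq (markovStep μξ T μ₁) (markovStep μξ T μ₂) ≤
      ∫⁻ p, ∫⁻ i, q2 (T i p.1) (T i p.2) ∂μξ ∂γ := by
    unfold W2sq
    refine iInf₂_le_of_le _ (hγ.map_prod hΦ μξ) (le_of_eq ?_)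
    rw [lintegral_map measurable_q2 (h₁.prodMk h₂), lintegral_prod _ hq.aemeasurable]
  calc
    _ ≤ (∫⁻ p, ∫⁻ i, q2 (T i p.1) (T i p.2) ∂μξ ∂γ) + ENNReal.ofReal ((1 - α) / α) *
          ∫⁻ p, (∫⁻ i, q2 (p.1 - T i p.1) (p.2 - T i p.2) ∂μξ) ∂γ := by gcongr
    _ = ∫⁻ p, ((∫⁻ i, q2 (T i p.1) (T i p.2) ∂μξ) + ENNReal.ofReal ((1 - α) / α) *
          ∫⁻ i, q2 (p.1 - T i p.1) (p.2 - T i p.2) ∂μξ) ∂γ := by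
      rw [lintegral_add_left hq.lintegral_prod_right',
        lintegral_const_mul' _ _ ENNReal.ofReal_ne_top]
    _ ≤ ∫⁻ p, ENNReal.ofReal (1 + ε) * q2 p.1 p.2 ∂γ :=
      lintegral_mono fun p => haafne p.1 p.2
    _ = _ := by rw [lintegral_const_mul _ measurable_q2, hopt]
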